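/- Let N = 2I range over even integers tending to infinity with class sizes N_s(N) (each positive) satisfying N_s(N)/N → p_s ∈ (0,1), Σ_s p_s = 1. For each N, let R_N := Σ_{1≤s<t≤K} a_{st} be the total cross-count under a uniformly random labeling. Then the standardized statistic Q_{K,N} := (R_N − E[R_N])/√Var(R_N) converges in distribution, as N → ∞, to the standard normal distribution N(0,1). -/

import Mathlib

open Finset Filter MeasureTheory ProbabilityTheory Topology

namespace Crossmatch

/-- First endpoint (index `2j`, i.e., the paper's `2j-1` in 1-based indexing) of the `j`-th
matched pair in the fixed perfect matching on `{1, …, 2I}`. -/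
def ep1 {I : ℕ} (j : Fin I) : Fin (2 * I) := ⟨2 * j.val, by have := j.isLt; omega⟩

/-- Second endpoint (index `2j+1`, i.e., the paper's `2j`) of the `j`-th matched pair. -/
def ep2 {I : ℕ} (j : Fin I) : Fin (2 * I) := ⟨2 * j.val + 1, by have := j.isLt; omega⟩

/-- The set of labelings `L : {1,…,2I} → {1,…,K}` assigning label `s` to exactly `Nc s`
indices, for every `s`. -/
def labelings (I K : ℕ) (Nc : Fin K → ℕ) : Finset (Fin (2 * I) → Fin K) :=
  univ.filter fun L => ∀ s : Fin K, (univ.filter fun i => L i = s).card = Nc s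

/-- The count `a_{st}(L)`: the number of matched pairs `j` with `{L(2j-1), L(2j)} = {s,t}`.
For `s ≠ t` this is the cross-count; for `s = t` it is the pure count (both endpoints labeled
`s`). -/
def crossCount (I K : ℕ) (L : Fin (2 * I) → Fin K) (s t : Fin K) : ℕ :=
  (univ.filter fun j : Fin I =>
    ({L (ep1 j), L (ep2 j)} : Finset (Fin K)) = ({s, t} : Finset (Fin K))).card

/-- Expectation of a real-valued statistic under a uniformly random labeling. -/
noncomputable def expct (I K : ℕ) (Nc : Fin K → ℕ)
    (X : (Fin (2 * I) → Fin K) → ℝ) : ℝ :=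
  (∑ L ∈ labelings I K Nc, X L) / ((labelings I K Nc).card : ℝ)

open Classical in
/-- Probability of an event under a uniformly random labeling. -/
noncomputable def pr (I K : ℕ) (Nc : Fin K → ℕ)
    (ev : (Fin (2 * I) → Fin K) → Prop) : ℝ :=
  (((labelings I K Nc).filter ev).card : ℝ) / ((labelings I K Nc).card : ℝ)

/-- Variance of a real-valued statistic under a uniformly random labeling. -/
noncomputable def variance (I K : ℕ) (Nc : Fin K → ℕ)
    (X : (Fin (2 * I) → Fin K) → ℝ) : ℝ :=
  expct I K Nc (fun L => (X L - expct I K Nc X) ^ 2)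

/-- Covariance of two real-valued statistics under a uniformly random labeling. -/
noncomputable def covar (I K : ℕ) (Nc : Fin K → ℕ)
    (X Y : (Fin (2 * I) → Fin K) → ℝ) : ℝ :=
  expct I K Nc (fun L => (X L - expct I K Nc X) * (Y L - expct I K Nc Y))

/-- The index set of (unordered) pairs `s < t`, indexing the cross-count vector. -/
abbrev Pairs (K : ℕ) := {q : Fin K × Fin K // q.1 < q.2}

/-- The covariance matrix of the cross-count vector `(a_{st})_{s<t}` under a uniformly
random labeling. -/
noncomputable def covMatrix (I K : ℕ) (Nc : Fin K → ℕ) :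
    Matrix (Pairs K) (Pairs K) ℝ :=
  Matrix.of fun q r =>
    covar I K Nc (fun L => (crossCount I K L q.1.1 q.1.2 : ℝ))
      (fun L => (crossCount I K L r.1.1 r.1.2 : ℝ))


lemma lin_identity {β ι E : Type*} [Fintype ι] [AddCommGroup E] [Module ℝ E] (Ω : Finset β)
    (τ : ι → β → β) (hΩ : ∀ i, ∀ L ∈ Ω, τ i L ∈ Ω) (hinv : ∀ i L, τ i (τ i L) = L)
    (S : β → ℝ) (g : β → E) :
    (2 : ℝ) • ∑ L ∈ Ω, ∑ i, (S (τ i L) - S L) • g L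
      = -∑ L ∈ Ω, ∑ i, (S (τ i L) - S L) • (g (τ i L) - g L) := by
  have key : ∑ L ∈ Ω, ∑ i, (S (τ i L) - S L) • g (τ i L)
      = - ∑ L ∈ Ω, ∑ i, (S (τ i L) - S L) • g L := by
    rw [sum_comm, sum_comm (s := Ω), ← sum_neg_distrib]
    refine sum_congr rfl fun i _ => ?_
    rw [← sum_neg_distrib]
    refine sum_nbij' (τ i) (τ i) (fun L hL => hΩ i L hL) (fun L hL => hΩ i L hL)
      (fun L _ => hinv i L) (fun L _ => hinv i L) ?_
    intro L _
    rw [hinv, ← neg_smul]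
    congr 1; ring
  simp only [smul_sub, sum_sub_distrib] at *
  rw [two_smul]
  simp only [sub_smul, sum_sub_distrib] at *
  rw [key]; abel

lemma exp_bound (x : ℝ) : ‖Complex.exp (Complex.I * x) - 1 - Complex.I * x‖ ≤ 2 * x ^ 2 := by
  by_cases hx : |x| ≤ 1
  · have h := Complex.norm_exp_sub_one_sub_id_le (x := Complex.I * x) (by simpa using hx)
    have h2 : ‖Complex.I * (x : ℂ)‖ ^ 2 = x ^ 2 := by simp
    rw [h2] at h
    nlinarith [sq_nonneg x]
  · push Not at hx
    have h1 := Real.norm_exp_I_mul_ofReal_sub_one_le (x := x)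
    have h2 := norm_sub_le (Complex.exp (Complex.I * x) - 1) (Complex.I * x)
    have h3 : ‖Complex.I * (x : ℂ)‖ = |x| := by simp
    rw [Real.norm_eq_abs] at h1
    rw [h3] at h2
    have h4 : x ^ 2 = |x| ^ 2 := (sq_abs x).symm
    rw [h4]
    nlinarith

section abstr
variable {β ι : Type*} [Fintype ι] (Ω : Finset β)
    (τ : ι → β → β) (hΩ : ∀ i, ∀ L ∈ Ω, τ i L ∈ Ω) (hinv : ∀ i L, τ i (τ i L) = L)
    (S : β → ℝ) (m c : ℝ) (hc : 0 < c)
    (hreg : ∀ L ∈ Ω, ∑ i, (S (τ i L) - S L) = c * (m - S L))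

include hΩ hinv hc hreg in
lemma abs_mean : ∑ L ∈ Ω, S L = Ω.card * m := by
  have h := lin_identity Ω τ hΩ hinv S (fun _ => (1 : ℝ))
  simp only [smul_eq_mul, mul_one, sub_self, mul_zero, sum_const_zero, neg_zero] at h
  rw [sum_congr rfl hreg, ← mul_sum, sum_sub_distrib, sum_const, nsmul_eq_mul] at h
  have : (Ω.card * m - ∑ L ∈ Ω, S L) = 0 := by
    rcases mul_eq_zero.1 h with h | h
    · norm_num at h
    · rcases mul_eq_zero.1 h with h | h
      · exact absurd h hc.ne'
      · exact h
  linarith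

include hΩ hinv hreg in
lemma abs_var : ∑ L ∈ Ω, ∑ i, (S (τ i L) - S L) ^ 2 = 2 * c * ∑ L ∈ Ω, (S L - m) ^ 2 := by
  have h := lin_identity Ω τ hΩ hinv S (fun L => S L - m)
  simp only [smul_eq_mul, ← sum_mul] at h
  have e1 : ∑ L ∈ Ω, (∑ i, (S (τ i L) - S L)) * (S L - m) = - (c * ∑ L ∈ Ω, (S L - m) ^ 2) := by
    rw [mul_sum, ← sum_neg_distrib]
    refine sum_congr rfl fun L hL => ?_
    rw [hreg L hL]; ring
  rw [e1] at h
  have e2 : ∑ L ∈ Ω, ∑ i, (S (τ i L) - S L) * (S (τ i L) - m - (S L - m))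
      = ∑ L ∈ Ω, ∑ i, (S (τ i L) - S L) ^ 2 := by
    refine sum_congr rfl fun L _ => sum_congr rfl fun i _ => ?_
    ring
  rw [e2] at h
  linarith

include hΩ hinv hc hreg in
lemma abs_deriv (B s t : ℝ) (hB : ∀ L ∈ Ω, ∀ i, |S (τ i L) - S L| ≤ B) (hs : 0 < s)
    (hvar : ∑ L ∈ Ω, (S L - m) ^ 2 = Ω.card * s ^ 2) :
    ‖∑ L ∈ Ω, (Complex.I * ((S L - m) / s : ℝ) *
        Complex.exp (Complex.I * (t * ((S L - m) / s) : ℝ)))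
      + t * ∑ L ∈ Ω, Complex.exp (Complex.I * (t * ((S L - m) / s) : ℝ))‖
    ≤ |t| * ∑ L ∈ Ω, |1 - (∑ i, (S (τ i L) - S L) ^ 2) / (2 * c * s ^ 2)|
      + 2 * t ^ 2 * B / s * Ω.card := by
  set u : β → ℂ := fun L => Complex.exp (Complex.I * (t * ((S L - m) / s) : ℝ)) with hu
  set D : ι → β → ℝ := fun i L => S (τ i L) - S L with hD
  set r : ι → β → ℂ := fun i L => Complex.exp (Complex.I * (t * (D i L / s) : ℝ)) - 1
    - Complex.I * (t * (D i L / s) : ℝ) with hr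
  set F : β → ℝ := fun L => ∑ i, D i L ^ 2 with hF
  have hun : ∀ L, ‖u L‖ = 1 := fun L => Complex.norm_exp_I_mul_ofReal _
  have hsC : (s : ℂ) ≠ 0 := by exact_mod_cast hs.ne'
  have hcC : (c : ℂ) ≠ 0 := by exact_mod_cast hc.ne'
  have h := lin_identity Ω τ hΩ hinv S u
  have hdiff : ∀ i L, u (τ i L) - u L = u L * (r i L + Complex.I * (t * (D i L / s) : ℝ)) := by
    intro i L
    have : u (τ i L) = u L * Complex.exp (Complex.I * (t * (D i L / s) : ℝ)) := by
      simp only [hu, hD]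
      rw [← Complex.exp_add]
      congr 1
      push_cast
      field_simp
      ring
    rw [this]; simp only [hr]; ring
  have e1 : ∑ L ∈ Ω, ∑ i, (S (τ i L) - S L) • u L
      = - (c * s * ∑ L ∈ Ω, ((S L - m) / s : ℝ) * u L) := by
    rw [mul_sum, ← sum_neg_distrib]
    refine sum_congr rfl fun L hL => ?_
    rw [← sum_smul, hreg L hL, Complex.real_smul]
    push_cast
    field_simp
    ring
  have e2 : ∑ L ∈ Ω, ∑ i, (S (τ i L) - S L) • (u (τ i L) - u L)
      = Complex.I * t / s * (∑ L ∈ Ω, (F L : ℂ) * u L) + ∑ L ∈ Ω, ∑ i, (D i L : ℂ) * u L * r i L := by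
    rw [mul_sum, ← sum_add_distrib]
    refine sum_congr rfl fun L _ => ?_
    simp only [hF]
    push_cast
    rw [sum_mul, mul_sum, ← sum_add_distrib]
    refine sum_congr rfl fun i _ => ?_
    rw [hdiff, Complex.real_smul]
    push_cast
    simp only [hD]; push_cast
    field_simp
    ring
  rw [e1, e2] at h
  rw [Complex.real_smul] at h
  push_cast at h
  have e3 : ∑ L ∈ Ω, (Complex.I * ((S L - m) / s : ℝ) * u L) + t * ∑ L ∈ Ω, u L
     = t * ∑ L ∈ Ω, ((1 - F L / (2 * c * s ^ 2) : ℝ) : ℂ) * u L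
      + Complex.I / (2 * c * s) * ∑ L ∈ Ω, ∑ i, (D i L : ℂ) * u L * r i L := by
    have a1 : ∑ L ∈ Ω, ((1 - F L / (2 * c * s ^ 2) : ℝ) : ℂ) * u L
       = ∑ L ∈ Ω, u L - 1 / (2 * c * s ^ 2) * ∑ L ∈ Ω, (F L : ℂ) * u L := by
      rw [mul_sum, ← sum_sub_distrib]
      refine sum_congr rfl fun L _ => ?_
      push_cast; ring
    have a2 : ∑ L ∈ Ω, (Complex.I * ((S L - m) / s : ℝ) * u L)
       = Complex.I * ∑ L ∈ Ω, ((S L - m) / s : ℝ) * u L := by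
      rw [mul_sum]
      refine sum_congr rfl fun L _ => by ring
    have a3 : ∑ L ∈ Ω, ((S L - m) / s : ℝ) * u L = 1 / (2 * c * s) *
       (Complex.I * t / s * (∑ L ∈ Ω, (F L : ℂ) * u L) + ∑ L ∈ Ω, ∑ i, (D i L : ℂ) * u L * r i L) := by
      rw [eq_comm, div_mul_eq_mul_div, div_eq_iff (mul_ne_zero (mul_ne_zero two_ne_zero hcC) hsC)]
      push_cast
      linear_combination h
    rw [a1, a2, a3]
    field_simp
    linear_combination (t * (∑ L ∈ Ω, (F L : ℂ) * u L)) * Complex.I_sq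
  rw [e3]
  refine (norm_add_le _ _).trans (add_le_add ?_ ?_)
  · rw [norm_mul, Complex.norm_real, Real.norm_eq_abs]
    refine mul_le_mul_of_nonneg_left ?_ (abs_nonneg _)
    refine (norm_sum_le _ _).trans (sum_le_sum fun L _ => ?_)
    rw [norm_mul, hun, mul_one, Complex.norm_real, Real.norm_eq_abs]
  · have hv := abs_var Ω τ hΩ hinv S m c hreg
    rw [norm_mul]
    have n1 : ‖Complex.I / (2 * c * s : ℂ)‖ = 1 / (2 * c * s) := by
      rw [norm_div, Complex.norm_I]
      congr 1
      have : (2 * c * s : ℂ) = ((2 * c * s : ℝ) : ℂ) := by push_cast; ring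
      rw [this, Complex.norm_real, Real.norm_eq_abs, abs_of_pos (by positivity)]
    have n2 : ‖∑ L ∈ Ω, ∑ i, (D i L : ℂ) * u L * r i L‖
        ≤ 2 * t ^ 2 * B / s ^ 2 * ∑ L ∈ Ω, ∑ i, (D i L) ^ 2 := by
      rw [mul_sum]
      refine (norm_sum_le _ _).trans (sum_le_sum fun L hL => ?_)
      rw [mul_sum]
      refine (norm_sum_le _ _).trans (sum_le_sum fun i _ => ?_)
      rw [norm_mul, norm_mul, hun, mul_one, Complex.norm_real, Real.norm_eq_abs]
      have b1 := hB L hL i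
      have b2 := exp_bound (t * (D i L / s))
      calc |D i L| * ‖r i L‖ ≤ B * (2 * (t * (D i L / s)) ^ 2) :=
            mul_le_mul b1 b2 (norm_nonneg _) ((abs_nonneg _).trans b1)
        _ = _ := by field_simp
    rw [n1]
    calc _ ≤ 1 / (2 * c * s) * (2 * t ^ 2 * B / s ^ 2 * ∑ L ∈ Ω, ∑ i, (D i L) ^ 2) :=
          mul_le_mul_of_nonneg_left n2 (by positivity)
      _ = _ := by
        simp only [hD]
        rw [hv, hvar]
        field_simp

include hΩ hinv hc hreg in
lemma abs_charFun (B s t : ℝ) (hne : Ω.Nonempty) (hB : ∀ L ∈ Ω, ∀ i, |S (τ i L) - S L| ≤ B)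
    (hs : 0 < s) (hB0 : 0 ≤ B)
    (hvar : ∑ L ∈ Ω, (S L - m) ^ 2 = Ω.card * s ^ 2) :
    ‖(∑ L ∈ Ω, Complex.exp (Complex.I * (t * ((S L - m) / s) : ℝ))) / (Ω.card : ℂ)
      - Complex.exp (- t ^ 2 / 2)‖
    ≤ Real.exp (t ^ 2 / 2) * (|t| * ((∑ L ∈ Ω, |1 - (∑ i, (S (τ i L) - S L) ^ 2) / (2 * c * s ^ 2)|)
          / Ω.card)
      + 2 * t ^ 2 * B / s) * |t| := by
  set W : β → ℝ := fun L => (S L - m) / s with hW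
  set A : ℝ := ∑ L ∈ Ω, |1 - (∑ i, (S (τ i L) - S L) ^ 2) / (2 * c * s ^ 2)| with hA
  have hA0 : 0 ≤ A := sum_nonneg fun _ _ => abs_nonneg _
  have hn : (0 : ℝ) < Ω.card := by exact_mod_cast hne.card_pos
  have hnC : (Ω.card : ℂ) ≠ 0 := by exact_mod_cast hn.ne'
  set φ : ℝ → ℂ := fun x => ∑ L ∈ Ω, Complex.exp (Complex.I * (x * W L : ℝ)) with hφ
  set φ' : ℝ → ℂ := fun x => ∑ L ∈ Ω, Complex.I * (W L : ℝ) * Complex.exp (Complex.I * (x * W L : ℝ)) with hφ'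
  have hd : ∀ x, HasDerivAt φ (φ' x) x := by
    intro x
    refine HasDerivAt.fun_sum fun L _ => ?_
    have h1 : HasDerivAt (fun x : ℝ => Complex.I * ((x * W L : ℝ) : ℂ)) (Complex.I * (W L : ℝ)) x := by
      have := (((hasDerivAt_id x).mul_const (W L)).ofReal_comp).const_mul Complex.I
      simpa using this
    have := h1.cexp
    convert! this using 1
    ring
  have hg : ∀ x : ℝ, HasDerivAt (fun x : ℝ => Complex.exp ((x ^ 2 / 2 : ℝ) : ℂ))
      (x * Complex.exp ((x ^ 2 / 2 : ℝ) : ℂ)) x := by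
    intro x
    have h1 : HasDerivAt (fun x : ℝ => ((x ^ 2 / 2 : ℝ) : ℂ)) ((x : ℝ) : ℂ) x := by
      have : HasDerivAt (fun x : ℝ => x ^ 2 / 2) x x := by
        have := (hasDerivAt_pow 2 x).div_const 2
        simpa using this
      exact this.ofReal_comp
    have := h1.cexp
    convert! this using 1
    ring
  set ψ : ℝ → ℂ := fun x => φ x * Complex.exp ((x ^ 2 / 2 : ℝ) : ℂ) with hψ
  have hψd : ∀ x, HasDerivAt ψ ((φ' x + x * φ x) * Complex.exp ((x ^ 2 / 2 : ℝ) : ℂ)) x := by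
    intro x
    convert! (hd x).mul (hg x) using 1
    ring
  set C : ℝ := (|t| * A + 2 * t ^ 2 * B / s * Ω.card) * Real.exp (t ^ 2 / 2) with hC
  have hmv := Convex.norm_image_sub_le_of_norm_hasDerivWithin_le (f := ψ) (C := C)
    (s := Set.Icc (-|t|) |t|) (x := 0) (y := t)
    (fun x _ => (hψd x).hasDerivWithinAt) ?_ (convex_Icc _ _) (by simp)
    (by constructor <;> [exact neg_abs_le t; exact le_abs_self t])
  · have h0 : ψ 0 = Ω.card := by simp [hψ, hφ]
    rw [h0, sub_zero, Real.norm_eq_abs] at hmv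
    have e1 : φ t / (Ω.card : ℂ) - Complex.exp (- t ^ 2 / 2)
       = (ψ t - Ω.card) * (Complex.exp (- t ^ 2 / 2) / Ω.card) := by
      have : Complex.exp ((t ^ 2 / 2 : ℝ) : ℂ) * Complex.exp (- t ^ 2 / 2) = 1 := by
        rw [← Complex.exp_add]
        push_cast
        rw [show (t : ℂ) ^ 2 / 2 + - t ^ 2 / 2 = 0 by ring, Complex.exp_zero]
      simp only [hψ]
      generalize Complex.exp (- t ^ 2 / 2) = e at *
      field_simp
      linear_combination (- φ t) * this
    rw [e1, norm_mul]
    have e2 : ‖Complex.exp (- t ^ 2 / 2) / (Ω.card : ℂ)‖ ≤ 1 / Ω.card := by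
      rw [norm_div, Complex.norm_natCast]
      refine div_le_div_of_nonneg_right ?_ hn.le
      have : (- t ^ 2 / 2 : ℂ) = ((- t ^ 2 / 2 : ℝ) : ℂ) := by push_cast; ring
      rw [this, Complex.norm_exp, Complex.ofReal_re, Real.exp_le_one_iff]
      nlinarith [sq_nonneg t]
    calc _ ≤ C * |t| * (1 / Ω.card) := mul_le_mul hmv e2 (norm_nonneg _) (by positivity)
      _ = _ := by rw [hC]; field_simp
  · intro x hx
    have hxt : |x| ≤ |t| := abs_le.2 hx
    have hx2 : x ^ 2 ≤ t ^ 2 := sq_le_sq.2 hxt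
    rw [norm_mul]
    refine mul_le_mul ?_ ?_ (norm_nonneg _) (by positivity)
    · refine (abs_deriv Ω τ hΩ hinv S m c hc hreg B s x hB hs hvar).trans ?_
      gcongr
    · rw [Complex.norm_exp, Complex.ofReal_re]
      gcongr
end abstr
set_option linter.unusedSectionVars false

section comb
variable {α κ : Type*} [Fintype α] [DecidableEq α] [Fintype κ] [DecidableEq κ]

/-- edge statistic -/
def SS (σ : α → α) (h : κ → κ → ℝ) (L : α → κ) : ℝ := ∑ i, h (L i) (L (σ i))

/-- swap of labels -/
def sw (q : α × α) (L : α → κ) : α → κ := L ∘ Equiv.swap q.1 q.2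

/-- local increment -/
def GG (h : κ → κ → ℝ) (q r : κ × κ) : ℝ :=
  2 * (h r.1 q.2 + h q.1 r.2 - h q.1 q.2 - h r.1 r.2)

lemma sw_sw (q : α × α) (L : α → κ) : sw q (sw q L) = L := by
  funext x; simp [sw]

variable (σ : α → α) (hσ : Function.Involutive σ) (hσ' : ∀ i, σ i ≠ i)
  (h : κ → κ → ℝ) (hsym : ∀ a b, h a b = h b a)

include hσ hσ' hsym in
lemma swap_formula (L : α → κ) (i j : α) :
    SS σ h (sw (i, j) L) - SS σ h L
      = if j = σ i then 0 else GG h (L i, L (σ i)) (L j, L (σ j)) := by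
  split_ifs with hj
  · subst hj
    rw [sub_eq_zero]
    unfold SS
    rw [← Equiv.sum_comp (Equiv.swap i (σ i)) (fun k => h (L k) (L (σ k)))]
    refine sum_congr rfl fun k _ => ?_
    have : σ (Equiv.swap i (σ i) k) = Equiv.swap i (σ i) (σ k) := by
      by_cases h1 : k = i
      · subst h1; simp [hσ k]
      · by_cases h2 : k = σ i
        · subst h2; simp [hσ i]
        · rw [Equiv.swap_apply_of_ne_of_ne h1 h2, Equiv.swap_apply_of_ne_of_ne]
          · intro h3; exact h2 (by rw [← h3, hσ k])
          · intro h3; exact h1 (hσ.injective h3)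
    simp only [sw, Function.comp]
    rw [this]
  · by_cases hij : j = i
    · subst hij
      simp [sw, GG]
    · unfold SS
      rw [← sum_sub_distrib]
      have hsub : ∑ k, (h (sw (i, j) L k) (sw (i, j) L (σ k)) - h (L k) (L (σ k)))
        = ∑ k ∈ ({i, j, σ i, σ j} : Finset α),
          (h (sw (i, j) L k) (sw (i, j) L (σ k)) - h (L k) (L (σ k))) := by
        symm
        refine sum_subset (subset_univ _) fun k _ hk => ?_
        simp only [mem_insert, mem_singleton, not_or] at hk
        obtain ⟨k1, k2, k3, k4⟩ := hk
        have k5 : σ k ≠ i := fun e => k3 (by rw [← e, hσ k])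
        have k6 : σ k ≠ j := fun e => k4 (by rw [← e, hσ k])
        simp only [sw, Function.comp]
        rw [Equiv.swap_apply_of_ne_of_ne k1 k2, Equiv.swap_apply_of_ne_of_ne k5 k6, sub_self]
      have hij' : i ≠ j := fun e => hij e.symm
      have h1 : i ≠ σ i := (hσ' i).symm
      have h2 : j ≠ σ j := (hσ' j).symm
      have h3 : i ≠ σ j := fun e => hj (by rw [e, hσ j])
      have h4 : σ i ≠ σ j := fun e => hij' (hσ.injective e)
      rw [hsub, sum_insert (by simp [hij', h1, h3]), sum_insert (by simp [hj, h2]),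
        sum_insert (by simp [h4]), sum_singleton]
      simp only [sw, Function.comp, hσ i, hσ j, Equiv.swap_apply_left, Equiv.swap_apply_right]
      rw [Equiv.swap_apply_of_ne_of_ne h1.symm (fun e => hj e.symm),
        Equiv.swap_apply_of_ne_of_ne h3.symm h2.symm]
      simp only [GG]
      rw [hsym (L (σ i)) (L j), hsym (L (σ i)) (L i), hsym (L (σ j)) (L i), hsym (L (σ j)) (L j)]
      ring

include hσ hσ' hsym in
lemma sum_swap (Φ : ℝ → ℝ) (hΦ : Φ 0 = 0) (L : α → κ) :
    ∑ q : α × α, Φ (SS σ h (sw q L) - SS σ h L)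
      = ∑ i, ∑ j, Φ (GG h (L i, L (σ i)) (L j, L (σ j)))
        - ∑ i, Φ (GG h (L i, L (σ i)) (L (σ i), L i)) := by
  rw [Fintype.sum_prod_type, ← sum_sub_distrib]
  refine sum_congr rfl fun i _ => ?_
  have : ∀ j, Φ (SS σ h (sw (i, j) L) - SS σ h L)
     = Φ (GG h (L i, L (σ i)) (L j, L (σ j)))
       - if j = σ i then Φ (GG h (L i, L (σ i)) (L j, L (σ j))) else 0 := by
    intro j
    rw [swap_formula σ hσ hσ' h hsym]
    split_ifs <;> simp [hΦ]
  simp only [this, sum_sub_distrib]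
  simp [hσ i]

include hσ hσ' hsym in
lemma sum_swap_lin (L : α → κ) :
    ∑ q : α × α, (SS σ h (sw q L) - SS σ h L)
      = 4 * (∑ i, ∑ j, h (L i) (L j) - ∑ i, h (L i) (L i))
        - 4 * ((Fintype.card α : ℝ) - 1) * SS σ h L := by
  have key := sum_swap σ hσ hσ' h hsym (fun x => x) rfl L
  rw [key]
  have r1 : ∀ f : α → ℝ, ∑ i, f (σ i) = ∑ i, f i := fun f =>
    Equiv.sum_comp hσ.toPerm f
  simp only [GG, ← mul_sum, sum_add_distrib, sum_sub_distrib]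
  have t1 : ∑ i, ∑ j, h (L j) (L (σ i)) = ∑ i, ∑ j, h (L i) (L j) := by
    rw [r1 (fun i => ∑ j, h (L j) (L i)), sum_comm]
  have t2 : ∑ i, ∑ j, h (L i) (L (σ j)) = ∑ i, ∑ j, h (L i) (L j) := by
    refine sum_congr rfl fun i _ => ?_
    rw [r1 (fun j => h (L i) (L j))]
  have t3 : ∑ i, h (L (σ i)) (L (σ i)) = ∑ i, h (L i) (L i) := r1 (fun i => h (L i) (L i))
  have t4 : ∑ i, h (L (σ i)) (L i) = ∑ i, h (L i) (L (σ i)) :=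
    sum_congr rfl fun i _ => hsym _ _
  rw [t1, t2, t3, t4]
  simp only [sum_const, card_univ, nsmul_eq_mul, SS, ← mul_sum]
  ring

/-- labelings -/
def lab (Nc : κ → ℕ) : Finset (α → κ) :=
  univ.filter fun L => ∀ s, (univ.filter fun i => L i = s).card = Nc s

lemma sw_mem (Nc : κ → ℕ) (q : α × α) (L : α → κ) (hL : L ∈ lab Nc) : sw q L ∈ lab Nc := by
  simp only [lab, mem_filter, mem_univ, true_and] at *
  intro s
  rw [← hL s]
  refine card_bij' (fun i _ => Equiv.swap q.1 q.2 i) (fun i _ => Equiv.swap q.1 q.2 i) ?_ ?_ ?_ ?_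
  · intro i hi
    rw [mem_filter] at hi ⊢
    simpa [sw] using hi
  · intro i hi
    rw [mem_filter] at hi ⊢
    simpa [sw] using hi
  · intro i _; simp
  · intro i _; simp

lemma sum_lab (Nc : κ → ℕ) (L : α → κ) (hL : L ∈ lab Nc) (f : κ → ℝ) :
    ∑ i, f (L i) = ∑ a, Nc a * f a := by
  simp only [lab, mem_filter, mem_univ, true_and] at hL
  rw [← sum_fiberwise univ L (fun i => f (L i))]
  refine sum_congr rfl fun a _ => ?_
  rw [← hL a, ← nsmul_eq_mul, ← sum_const]
  refine sum_congr rfl fun i hi => ?_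
  rw [(mem_filter.1 hi).2]

/-- mean -/
noncomputable def mm (N : ℝ) (Nc : κ → ℕ) (h : κ → κ → ℝ) : ℝ :=
  (∑ a, Nc a * ∑ b, Nc b * h a b - ∑ a, Nc a * h a a) / (N - 1)

include hσ hσ' hsym in
lemma reg (Nc : κ → ℕ) (hN : 1 < Fintype.card α) (L : α → κ) (hL : L ∈ lab Nc) :
    ∑ q : α × α, (SS σ h (sw q L) - SS σ h L)
      = 4 * ((Fintype.card α : ℝ) - 1) * (mm (Fintype.card α) Nc h - SS σ h L) := by
  rw [sum_swap_lin σ hσ hσ' h hsym]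
  have hN' : (0 : ℝ) < (Fintype.card α : ℝ) - 1 := by
    have : (1 : ℝ) < Fintype.card α := by exact_mod_cast hN
    linarith
  have e1 : ∑ i, ∑ j, h (L i) (L j) = ∑ a, Nc a * ∑ b, Nc b * h a b := by
    rw [← sum_lab Nc L hL (fun a => ∑ b, Nc b * h a b)]
    exact sum_congr rfl fun i _ => sum_lab Nc L hL (fun b => h (L i) b)
  have e2 := sum_lab Nc L hL (fun a => h a a)
  rw [e1, e2, mm]
  field_simp

lemma GG_bound (h01 : ∀ a b, 0 ≤ h a b ∧ h a b ≤ 1) (q r : κ × κ) : |GG h q r| ≤ 4 := by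
  unfold GG
  have a1 := h01 r.1 q.2
  have a2 := h01 q.1 r.2
  have a3 := h01 q.1 q.2
  have a4 := h01 r.1 r.2
  rw [abs_le]; constructor <;> linarith

include hσ hσ' hsym in
lemma D_bound (h01 : ∀ a b, 0 ≤ h a b ∧ h a b ≤ 1) (L : α → κ) (q : α × α) :
    |SS σ h (sw q L) - SS σ h L| ≤ 4 := by
  obtain ⟨i, j⟩ := q
  rw [swap_formula σ hσ hσ' h hsym]
  split_ifs
  · simp
  · exact GG_bound h h01 _ _

/-- ordered pair counts -/
def XX (q : κ × κ) (L : α → κ) : ℝ := ∑ i, if (L i, L (σ i)) = q then (1 : ℝ) else 0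

/-- symmetrised indicator -/
noncomputable def hh (q : κ × κ) (x y : κ) : ℝ :=
  ((if (x, y) = q then (1 : ℝ) else 0) + (if (y, x) = q then (1 : ℝ) else 0)) / 2

include hσ in
lemma XX_eq (q : κ × κ) (L : α → κ) : XX σ q L = SS σ (hh q) L := by
  have r1 : ∑ i, (if (L (σ i), L i) = q then (1 : ℝ) else 0) = XX σ q L := by
    unfold XX
    rw [← Equiv.sum_comp hσ.toPerm (fun i => if (L i, L (σ i)) = q then (1 : ℝ) else 0)]
    refine sum_congr rfl fun i _ => ?_
    simp [hσ i]
  unfold SS hh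
  rw [← sum_div, sum_add_distrib, r1]
  unfold XX
  ring

lemma hh_sym (q : κ × κ) (a b : κ) : hh q a b = hh q b a := by
  unfold hh; ring

lemma hh_01 (q : κ × κ) (a b : κ) : 0 ≤ hh q a b ∧ hh q a b ≤ 1 := by
  unfold hh; split_ifs <;> norm_num

lemma mm_hh (N : ℝ) (Nc : κ → ℕ) (q : κ × κ) :
    mm N Nc (hh q) = (Nc q.1 * Nc q.2 - if q.1 = q.2 then (Nc q.1 : ℝ) else 0) / (N - 1) := by
  obtain ⟨a, b⟩ := q
  unfold mm hh
  congr 1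
  have e1 : ∀ x : κ, ∑ y, (Nc y : ℝ) * (((if (x, y) = (a, b) then (1 : ℝ) else 0)
      + (if (y, x) = (a, b) then (1 : ℝ) else 0)) / 2)
      = ((if x = a then (Nc b : ℝ) else 0) + (if x = b then (Nc a : ℝ) else 0)) / 2 := by
    intro x
    simp only [Prod.mk.injEq, ite_and, mul_div_assoc', ← sum_div, mul_add, sum_add_distrib]
    congr 2
    · split_ifs <;> simp
    · simp
  simp only [e1]
  have e2 : ∑ x, (Nc x : ℝ) * (((if x = a then (Nc b : ℝ) else 0) + (if x = b then (Nc a : ℝ) else 0)) / 2)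
     = Nc a * Nc b := by
    simp only [mul_div_assoc', ← sum_div, mul_add, sum_add_distrib]
    simp
    ring
  rw [e2]
  congr 1
  simp only [Prod.mk.injEq, ite_and, add_self_div_two]
  simp

end comb

section lln
variable {α κ : Type*} [Fintype α] [DecidableEq α] [Fintype κ] [DecidableEq κ]
variable (σ : α → α) (hσ : Function.Involutive σ) (hσ' : ∀ i, σ i ≠ i)

include hσ hσ' in
lemma ebound (Nc : κ → ℕ) (hne : (lab (α := α) Nc).Nonempty) (hN : 2 ≤ Fintype.card α)
    (q : κ × κ) (π : ℝ) :
    (∑ L ∈ lab Nc, |XX σ q L / (Fintype.card α : ℝ) - π|) / ((lab (α := α) Nc).card : ℝ)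
      ≤ √(4 / (Fintype.card α : ℝ)) + |mm (Fintype.card α) Nc (hh q) / (Fintype.card α : ℝ) - π| := by
  set N : ℝ := (Fintype.card α : ℝ) with hNdef
  set n : ℝ := ((lab (α := α) Nc).card : ℝ) with hn
  set m := mm N Nc (hh q) with hm
  have hN2 : (2 : ℝ) ≤ N := by rw [hNdef]; exact_mod_cast hN
  have hn0 : 0 < n := by rw [hn]; exact_mod_cast hne.card_pos
  have hv := abs_var (lab (α := α) Nc) sw (fun i L hL => sw_mem Nc i L hL) sw_sw (SS σ (hh q)) m
    (4 * (N - 1)) (fun L hL => reg σ hσ hσ' (hh q) (hh_sym q) Nc (by omega) L hL)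
  have hF : ∑ L ∈ lab (α := α) Nc, ∑ i, (SS σ (hh q) (sw i L) - SS σ (hh q) L) ^ 2 ≤ n * (N ^ 2 * 16) := by
    rw [hn, ← nsmul_eq_mul]
    refine sum_le_card_nsmul _ _ _ fun L _ => ?_
    have : (N ^ 2 * 16 : ℝ) = (univ : Finset (α × α)).card • (16 : ℝ) := by
      rw [card_univ, Fintype.card_prod, nsmul_eq_mul]; push_cast; ring
    rw [this]
    refine sum_le_card_nsmul _ _ _ fun i _ => ?_
    have := D_bound σ hσ hσ' (hh q) (hh_sym q) (hh_01 q) L i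
    rw [← sq_abs]
    nlinarith [abs_nonneg (SS σ (hh q) (sw i L) - SS σ (hh q) L)]
  rw [hv] at hF
  have hV : ∑ L ∈ lab (α := α) Nc, (SS σ (hh q) L - m) ^ 2 ≤ n * (4 * N) := by
    have h0 : 0 ≤ ∑ L ∈ lab (α := α) Nc, (SS σ (hh q) L - m) ^ 2 := sum_nonneg fun _ _ => sq_nonneg _
    have h1 : N * ∑ L ∈ lab (α := α) Nc, (SS σ (hh q) L - m) ^ 2 ≤ N * (n * (4 * N)) := by
      nlinarith
    exact le_of_mul_le_mul_left h1 (by linarith)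
  have hCS := sq_sum_le_card_mul_sum_sq (s := lab (α := α) Nc) (f := fun L => |SS σ (hh q) L - m|)
  simp only [sq_abs] at hCS
  have hkey : (∑ L ∈ lab (α := α) Nc, |SS σ (hh q) L - m|) / (n * N) ≤ √(4 / N) := by
    refine Real.le_sqrt_of_sq_le ?_
    rw [div_pow, div_le_div_iff₀ (by positivity) (by linarith)]
    have : (∑ L ∈ lab (α := α) Nc, |SS σ (hh q) L - m|) ^ 2 ≤ n * (n * (4 * N)) :=
      hCS.trans (mul_le_mul_of_nonneg_left hV hn0.le)
    nlinarith
  calc _ ≤ (∑ L ∈ lab (α := α) Nc, (|SS σ (hh q) L - m| / N + |m / N - π|)) / n := by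
        gcongr with L _
        rw [XX_eq σ hσ]
        have : SS σ (hh q) L / N - π = (SS σ (hh q) L - m) / N + (m / N - π) := by ring
        rw [this]
        refine (abs_add_le _ _).trans ?_
        rw [abs_div, abs_of_pos (show 0 < N by linarith)]
    _ = (∑ L ∈ lab (α := α) Nc, |SS σ (hh q) L - m|) / (n * N) + |m / N - π| := by
        rw [sum_add_distrib, sum_const, nsmul_eq_mul, ← sum_div, ← hn]
        field_simp
    _ ≤ _ := by gcongr

variable (h : κ → κ → ℝ) (hsym : ∀ a b, h a b = h b a)

include hσ hσ' hsym in
lemma Fbound (h01 : ∀ a b, 0 ≤ h a b ∧ h a b ≤ 1)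
    (Nc : κ → ℕ) (hne : (lab (α := α) Nc).Nonempty) (hN : 2 ≤ Fintype.card α)
    (π : κ × κ → ℝ) (hπ : ∀ q, 0 ≤ π q ∧ π q ≤ 1) :
    (∑ L ∈ lab (α := α) Nc, |(∑ i, (SS σ h (sw i L) - SS σ h L) ^ 2) / (Fintype.card α : ℝ) ^ 2
        - ∑ q, ∑ r, GG h q r ^ 2 * (π q * π r)|) / ((lab (α := α) Nc).card : ℝ)
      ≤ ∑ q, ∑ r, GG h q r ^ 2 *
        ((∑ L ∈ lab Nc, |XX σ q L / (Fintype.card α : ℝ) - π q|) / ((lab (α := α) Nc).card : ℝ)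
        + (∑ L ∈ lab Nc, |XX σ r L / (Fintype.card α : ℝ) - π r|) / ((lab (α := α) Nc).card : ℝ))
        + 16 / (Fintype.card α : ℝ) := by
  set N : ℝ := (Fintype.card α : ℝ) with hNdef
  set n : ℝ := ((lab (α := α) Nc).card : ℝ) with hn
  have hN2 : (2 : ℝ) ≤ N := by rw [hNdef]; exact_mod_cast hN
  have hn0 : 0 < n := by rw [hn]; exact_mod_cast hne.card_pos
  have hx : ∀ q (L : α → κ), 0 ≤ XX σ q L / N ∧ XX σ q L / N ≤ 1 := by
    intro q L
    constructor
    · refine div_nonneg (sum_nonneg fun i _ => ?_) (by linarith)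
      split_ifs <;> norm_num
    · rw [div_le_one (by linarith)]
      calc XX σ q L ≤ ∑ i : α, (1 : ℝ) := sum_le_sum fun i _ => by split_ifs <;> norm_num
        _ = N := by simp [hNdef]
  have hcount : ∀ (L : α → κ) (f : κ × κ → ℝ), ∑ i, f (L i, L (σ i)) = ∑ q, XX σ q L * f q := by
    intro L f
    unfold XX
    simp only [sum_mul]
    rw [sum_comm]
    refine sum_congr rfl fun i _ => ?_
    simp
  have hpt : ∀ L : α → κ, |(∑ i, (SS σ h (sw i L) - SS σ h L) ^ 2) / N ^ 2
        - ∑ q, ∑ r, GG h q r ^ 2 * (π q * π r)|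
      ≤ ∑ q, ∑ r, GG h q r ^ 2 * (|XX σ q L / N - π q| + |XX σ r L / N - π r|) + 16 / N := by
    intro L
    rw [sum_swap σ hσ hσ' h hsym (fun x => x ^ 2) (by norm_num) L]
    have e1 : ∑ i, ∑ j, GG h (L i, L (σ i)) (L j, L (σ j)) ^ 2
        = ∑ q, ∑ r, GG h q r ^ 2 * (XX σ q L * XX σ r L) := by
      refine Eq.trans (sum_congr rfl fun i _ => hcount L (fun r => GG h (L i, L (σ i)) r ^ 2)) ?_
      refine (hcount L (fun q => ∑ r, XX σ r L * GG h q r ^ 2)).trans ?_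
      · refine sum_congr rfl fun q _ => ?_
        rw [mul_sum]
        exact sum_congr rfl fun r _ => by ring
    have e2 : 0 ≤ ∑ i, GG h (L i, L (σ i)) (L (σ i), L i) ^ 2 := sum_nonneg fun _ _ => sq_nonneg _
    have e3 : ∑ i, GG h (L i, L (σ i)) (L (σ i), L i) ^ 2 ≤ 16 * N := by
      calc _ ≤ ∑ i : α, (16 : ℝ) := sum_le_sum fun i _ => by
              have := GG_bound h h01 (L i, L (σ i)) (L (σ i), L i)
              rw [← sq_abs]
              nlinarith [abs_nonneg (GG h (L i, L (σ i)) (L (σ i), L i))]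
        _ = _ := by simp [hNdef]; ring
    rw [e1]
    set Y := ∑ i, GG h (L i, L (σ i)) (L (σ i), L i) ^ 2
    have e4 : (∑ q, ∑ r, GG h q r ^ 2 * (XX σ q L * XX σ r L) - Y) / N ^ 2
        - ∑ q, ∑ r, GG h q r ^ 2 * (π q * π r)
        = ∑ q, ∑ r, GG h q r ^ 2 * (XX σ q L / N * (XX σ r L / N) - π q * π r) - Y / N ^ 2 := by
      rw [sub_div, sum_div, sub_right_comm, ← sum_sub_distrib]
      congr 1
      refine sum_congr rfl fun q _ => ?_
      rw [sum_div, ← sum_sub_distrib]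
      refine sum_congr rfl fun r _ => ?_
      field_simp
    rw [e4]
    refine (abs_sub _ _).trans (add_le_add ?_ ?_)
    · refine (abs_sum_le_sum_abs _ _).trans (sum_le_sum fun q _ => ?_)
      refine (abs_sum_le_sum_abs _ _).trans (sum_le_sum fun r _ => ?_)
      rw [abs_mul, abs_of_nonneg (sq_nonneg (GG h q r))]
      refine mul_le_mul_of_nonneg_left ?_ (sq_nonneg _)
      have : XX σ q L / N * (XX σ r L / N) - π q * π r
        = (XX σ q L / N - π q) * (XX σ r L / N) + π q * (XX σ r L / N - π r) := by ring
      rw [this]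
      refine (abs_add_le _ _).trans (add_le_add ?_ ?_)
      · rw [abs_mul]
        refine mul_le_of_le_one_right (abs_nonneg _) ?_
        rw [abs_of_nonneg (hx r L).1]; exact (hx r L).2
      · rw [abs_mul]
        refine mul_le_of_le_one_left (abs_nonneg _) ?_
        rw [abs_of_nonneg (hπ q).1]; exact (hπ q).2
    · rw [abs_of_nonneg (by positivity), div_le_div_iff₀ (by positivity) (by linarith)]
      nlinarith
  calc _ ≤ (∑ L ∈ lab (α := α) Nc, (∑ q, ∑ r, GG h q r ^ 2 *
            (|XX σ q L / N - π q| + |XX σ r L / N - π r|) + 16 / N)) / n := by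
        gcongr with L _
        exact hpt L
    _ = _ := by
        rw [sum_add_distrib, sum_const, nsmul_eq_mul, ← hn, add_div]
        congr 1
        · rw [sum_comm, sum_div]
          refine sum_congr rfl fun q _ => ?_
          rw [sum_comm, sum_div]
          refine sum_congr rfl fun r _ => ?_
          rw [← mul_sum, sum_add_distrib]
          ring
        · field_simp
end lln

lemma weak {β : ℕ → Type} (Ω : ∀ n, Finset (β n)) (W : ∀ n, β n → ℝ)
    (hne : ∀ᶠ n in atTop, (Ω n).Nonempty)
    (hφ : ∀ t : ℝ, Tendsto (fun n => (∑ L ∈ Ω n, Complex.exp (Complex.I * (t * W n L : ℝ)))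
        / ((Ω n).card : ℂ)) atTop (𝓝 (Complex.exp (- t ^ 2 / 2))))
    (f : BoundedContinuousFunction ℝ ℝ) :
    Tendsto (fun n => (∑ L ∈ Ω n, f (W n L)) / ((Ω n).card : ℝ)) atTop
      (𝓝 (∫ x, f x ∂(gaussianReal 0 1))) := by
  classical
  let ν : ℕ → Measure ℝ := fun n => if (Ω n).Nonempty then
    ((Ω n).card : ENNReal)⁻¹ • ∑ L ∈ Ω n, Measure.dirac (W n L) else Measure.dirac 0
  have hν : ∀ n, IsProbabilityMeasure (ν n) := by
    intro n
    by_cases h : (Ω n).Nonempty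
    · simp only [ν, if_pos h]
      constructor
      have h0 : ((Ω n).card : ENNReal) ≠ 0 := by exact_mod_cast h.card_pos.ne'
      simp only [Measure.smul_apply, Measure.finsetSum_apply, measure_univ, sum_const, smul_eq_mul,
        nsmul_eq_mul, mul_one]
      exact ENNReal.inv_mul_cancel h0 (ENNReal.natCast_ne_top _)
    · simp only [ν, if_neg h]
      infer_instance
  have hint : ∀ n, (Ω n).Nonempty → ∀ {E : Type} [NormedAddCommGroup E] [NormedSpace ℝ E]
      [CompleteSpace E] (g : ℝ → E), ∫ x, g x ∂(ν n) = ((Ω n).card : ℝ)⁻¹ • ∑ L ∈ Ω n, g (W n L) := by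
    intro n h E _ _ _ g
    simp only [ν, if_pos h]
    rw [integral_smul_measure, integral_finsetSum_measure]
    · simp
    · intro L _
      exact integrable_dirac (by simp)
  let μ : ℕ → ProbabilityMeasure ℝ := fun n => ⟨ν n, hν n⟩
  have hμ : Tendsto μ atTop (𝓝 ⟨gaussianReal 0 1, inferInstance⟩) := by
    refine ProbabilityMeasure.tendsto_of_tendsto_charFun fun t => ?_
    have e : charFun (gaussianReal 0 1) t = Complex.exp (- t ^ 2 / 2) := by
      rw [charFun_gaussianReal]; congr 1; simp; ring
    simp only [ProbabilityMeasure.coe_mk, e]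
    refine (hφ t).congr' ?_
    filter_upwards [hne] with n hn
    simp only [μ, ProbabilityMeasure.coe_mk]
    rw [charFun_apply_real, hint n hn, Complex.real_smul]
    push_cast
    rw [div_eq_inv_mul]
    congr 1
    refine sum_congr rfl fun L _ => ?_
    congr 1; ring
  have := (ProbabilityMeasure.tendsto_iff_forall_integral_tendsto.1 hμ) f
  refine this.congr' ?_
  filter_upwards [hne] with n hn
  simp only [μ, ProbabilityMeasure.coe_mk]
  rw [hint n hn, smul_eq_mul, div_eq_inv_mul]


/-- partner -/
def ptn {n : ℕ} (i : Fin (2 * n)) : Fin (2 * n) :=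
  ⟨if i.val % 2 = 0 then i.val + 1 else i.val - 1, by have := i.isLt; split_ifs <;> omega⟩

lemma ptn_inv {n : ℕ} : Function.Involutive (ptn (n := n)) := by
  intro i
  apply Fin.ext
  simp only [ptn]
  split_ifs <;> omega

lemma ptn_ne {n : ℕ} (i : Fin (2 * n)) : ptn i ≠ i := by
  intro h
  have := congrArg Fin.val h
  simp only [ptn] at this
  split_ifs at this <;> omega

lemma ptn_ep1 {n : ℕ} (j : Fin n) : ptn (ep1 j) = ep2 j := by
  apply Fin.ext
  simp [ptn, ep1, ep2]

lemma ptn_ep2 {n : ℕ} (j : Fin n) : ptn (ep2 j) = ep1 j := by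
  rw [← ptn_ep1, ptn_inv]

lemma sum_ep {n : ℕ} (f : Fin (2 * n) → ℝ) : ∑ i, f i = ∑ j : Fin n, (f (ep1 j) + f (ep2 j)) := by
  have hb : Function.Bijective (Sum.elim ep1 ep2 : Fin n ⊕ Fin n → Fin (2 * n)) := by
    constructor
    · rintro (a | a) (b | b) hab <;> have := congrArg Fin.val hab <;>
        simp only [Sum.elim_inl, Sum.elim_inr, ep1, ep2] at this
      · congr 1; apply Fin.ext; omega
      · omega
      · omega
      · congr 1; apply Fin.ext; omega
    · intro i
      have hi := i.isLt
      by_cases h : i.val % 2 = 0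
      · refine ⟨Sum.inl ⟨i.val / 2, by omega⟩, ?_⟩
        apply Fin.ext
        simp only [Sum.elim_inl, ep1]; omega
      · refine ⟨Sum.inr ⟨i.val / 2, by omega⟩, ?_⟩
        apply Fin.ext
        simp only [Sum.elim_inr, ep2]; omega
  rw [← hb.sum_comp, Fintype.sum_sum_type, sum_add_distrib]
  rfl

/-- unlike indicator -/
def hne (K : ℕ) (a b : Fin K) : ℝ := if a = b then 0 else 1

lemma hne_sym (K : ℕ) (a b : Fin K) : hne K a b = hne K b a := by
  simp [hne, eq_comm]

lemma hne_01 (K : ℕ) (a b : Fin K) : 0 ≤ hne K a b ∧ hne K a b ≤ 1 := by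
  unfold hne; split_ifs <;> norm_num

lemma fpair {K : ℕ} (x y s t : Fin K) : (({x, y} : Finset (Fin K)) = {s, t})
    ↔ (x = s ∧ y = t ∨ x = t ∧ y = s) := by
  rw [← Finset.coe_inj]
  push_cast
  exact Set.pair_eq_pair_iff

lemma pair_sum {K : ℕ} (x y : Fin K) :
    ∑ q ∈ univ.filter (fun q : Fin K × Fin K => q.1 < q.2),
      (if ({x, y} : Finset (Fin K)) = {q.1, q.2} then (1 : ℝ) else 0) = hne K x y := by
  unfold hne
  simp only [fpair]
  rcases lt_trichotomy x y with h | h | h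
  · rw [if_neg h.ne, sum_eq_single (x, y)]
    · simp
    · rintro ⟨s, t⟩ hq hne
      rw [if_neg]
      rintro (⟨rfl, rfl⟩ | ⟨rfl, rfl⟩)
      · exact hne rfl
      · exact absurd (mem_filter.1 hq).2 (not_lt.2 h.le)
    · intro hq
      exact (hq (by rw [mem_filter]; exact ⟨mem_univ _, h⟩)).elim
  · subst h
    rw [if_pos rfl]
    refine sum_eq_zero ?_
    rintro ⟨s, t⟩ hq
    have := (mem_filter.1 hq).2
    rw [if_neg]
    rintro (⟨rfl, rfl⟩ | ⟨rfl, rfl⟩) <;> exact lt_irrefl _ this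
  · rw [if_neg h.ne', sum_eq_single (y, x)]
    · simp
    · rintro ⟨s, t⟩ hq hne
      rw [if_neg]
      rintro (⟨rfl, rfl⟩ | ⟨rfl, rfl⟩)
      · exact absurd (mem_filter.1 hq).2 (not_lt.2 h.le)
      · exact hne rfl
    · intro hq
      exact (hq (by rw [mem_filter]; exact ⟨mem_univ _, h⟩)).elim

lemma R_eq (n K : ℕ) (L : Fin (2 * n) → Fin K) :
    ∑ q ∈ univ.filter (fun q : Fin K × Fin K => q.1 < q.2), (crossCount n K L q.1 q.2 : ℝ)
      = SS ptn (hne K) L / 2 := by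
  have e1 : ∀ q : Fin K × Fin K, (crossCount n K L q.1 q.2 : ℝ) = ∑ j : Fin n,
      (if ({L (ep1 j), L (ep2 j)} : Finset (Fin K)) = {q.1, q.2} then (1 : ℝ) else 0) := by
    intro q
    simp [crossCount]
  simp only [e1]
  rw [sum_comm]
  simp only [pair_sum]
  unfold SS
  rw [sum_ep, sum_div]
  refine sum_congr rfl fun j _ => ?_
  rw [ptn_ep1, ptn_ep2, hne_sym K (L (ep2 j))]
  ring

lemma lab_eq (n K : ℕ) (Nc : Fin K → ℕ) : labelings n K Nc = lab Nc := by
  unfold labelings lab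
  congr!

lemma lab_nonempty (n K : ℕ) (Nc : Fin K → ℕ) (h : ∑ s, Nc s = 2 * n) :
    (lab (α := Fin (2 * n)) Nc).Nonempty := by
  have hc : Fintype.card (Fin (2 * n)) = Fintype.card (Σ s : Fin K, Fin (Nc s)) := by
    simp [h]
  let e := Fintype.equivOfCardEq hc
  refine ⟨fun i => (e i).1, ?_⟩
  simp only [lab, mem_filter, mem_univ, true_and]
  intro s
  have : (Fintype.card (Fin (Nc s))) = Nc s := Fintype.card_fin _
  rw [← this, ← card_univ]
  symm
  refine card_bij (fun x _ => e.symm ⟨s, x⟩) ?_ ?_ ?_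
  · intro x _; simp
  · intro x _ y _ hxy
    have := e.symm.injective hxy
    simpa using this
  · intro i hi
    simp only [mem_filter, mem_univ, true_and] at hi
    obtain ⟨x, hx⟩ : ∃ x : Fin (Nc s), e i = ⟨s, x⟩ := by
      subst hi
      exact ⟨(e i).2, rfl⟩
    exact ⟨x, mem_univ _, by rw [← hx]; simp⟩

/-- the standardized multisample crossmatch statistic
`Q_{K,N} = (R_N - E R_N)/√Var(R_N)` converges in distribution, under the null (uniform
labeling) law, to the standard normal distribution. Convergence in distribution is phrased
via bounded continuous test functions. -/
theorem stmt12 (K : ℕ) (hK : 2 ≤ K)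
    (Nc : ℕ → Fin K → ℕ) (p : Fin K → ℝ)
    (hp : ∀ s, p s ∈ Set.Ioo (0 : ℝ) 1) (hps : ∑ s, p s = 1)
    (hlim : ∀ s, Tendsto (fun I : ℕ => (Nc I s : ℝ) / (2 * I : ℝ)) atTop (𝓝 (p s)))
    (hstruct : ∀ᶠ I : ℕ in atTop, (∀ s, 0 < Nc I s) ∧ (∑ s, Nc I s = 2 * I))
    (R : (I : ℕ) → (Fin (2 * I) → Fin K) → ℝ)
    (hR : ∀ I L, R I L = ∑ q ∈ univ.filter (fun q : Fin K × Fin K => q.1 < q.2),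
        (crossCount I K L q.1 q.2 : ℝ)) :
    ∀ f : BoundedContinuousFunction ℝ ℝ,
      Tendsto (fun I : ℕ => expct I K (Nc I) (fun L =>
          f ((R I L - expct I K (Nc I) (R I)) / Real.sqrt (variance I K (Nc I) (R I)))))
        atTop
        (𝓝 (∫ x, f x ∂(gaussianReal 0 1))) := by

  classical
  intro f
  have hNT : Tendsto (fun n : ℕ => (2 * n : ℝ)) atTop atTop :=
    tendsto_natCast_atTop_atTop.const_mul_atTop (by norm_num)
  -- names
  let h := hne K
  let π : Fin K × Fin K → ℝ := fun q => p q.1 * p q.2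
  have hπ : ∀ q, 0 ≤ π q ∧ π q ≤ 1 := fun q =>
    ⟨mul_nonneg (hp _).1.le (hp _).1.le, mul_le_one₀ (hp _).2.le (hp _).1.le (hp _).2.le⟩
  let Ω : (n : ℕ) → Finset (Fin (2 * n) → Fin K) := fun n => lab (Nc n)
  let S : (n : ℕ) → (Fin (2 * n) → Fin K) → ℝ := fun n L => SS ptn h L
  let F : (n : ℕ) → (Fin (2 * n) → Fin K) → ℝ := fun n L => ∑ i, (S n (sw i L) - S n L) ^ 2
  let m : ℕ → ℝ := fun n => mm (2 * n : ℝ) (Nc n) h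
  let c : ℕ → ℝ := fun n => 4 * ((2 * n : ℝ) - 1)
  let v : ℕ → ℝ := fun n => (∑ L ∈ Ω n, (S n L - m n) ^ 2) / ((Ω n).card : ℝ)
  let G : ℝ := ∑ q, ∑ r, GG h q r ^ 2 * (π q * π r)
  let d : ℕ → ℝ := fun n => (∑ L ∈ Ω n, |F n L / (2 * n : ℝ) ^ 2 - G|) / ((Ω n).card : ℝ)
  have hG : 0 < G := by
    have hnn : ∀ q r, 0 ≤ GG h q r ^ 2 * (π q * π r) := fun q r =>
      mul_nonneg (sq_nonneg _) (mul_nonneg (hπ q).1 (hπ r).1)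
    let a : Fin K := ⟨0, by omega⟩
    let b : Fin K := ⟨1, by omega⟩
    have hab : a ≠ b := by intro e; have := congrArg Fin.val e; simp [a, b] at this
    refine sum_pos' (fun q _ => sum_nonneg fun r _ => hnn q r) ⟨(a, a), mem_univ _, ?_⟩
    refine sum_pos' (fun r _ => hnn _ r) ⟨(b, b), mem_univ _, ?_⟩
    have : GG h (a, a) (b, b) = 4 := by
      simp [GG, h, hne, hab, hab.symm]; norm_num
    rw [this]
    have h1 := (hp a).1
    have h2 := (hp b).1
    simp only [π]
    positivity
  have hgood : ∀ᶠ n : ℕ in atTop, (Ω n).Nonempty ∧ 1 ≤ n := by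
    filter_upwards [hstruct, eventually_ge_atTop 1] with n hn h1
    exact ⟨lab_nonempty n K _ hn.2, h1⟩
  have hcard : ∀ n : ℕ, ((Fintype.card (Fin (2 * n)) : ℕ) : ℝ) = 2 * n := by
    intro n; simp
  have hreg : ∀ n, 1 ≤ n → ∀ L ∈ Ω n, ∑ i, (S n (sw i L) - S n L) = c n * (m n - S n L) := by
    intro n hn L hL
    have := reg ptn ptn_inv ptn_ne h (hne_sym K) (Nc n) (by simp; omega) L hL
    rw [hcard] at this
    exact this
  have hcpos : ∀ n : ℕ, 1 ≤ n → 0 < c n := by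
    intro n hn
    have : (1 : ℝ) ≤ n := by exact_mod_cast hn
    simp only [c]; linarith
  -- e_q → 0
  have he : ∀ q, Tendsto (fun n : ℕ => (∑ L ∈ Ω n, |XX ptn q L / (2 * n : ℝ) - π q|)
      / ((Ω n).card : ℝ)) atTop (𝓝 0) := by
    intro q
    have hb : Tendsto (fun n : ℕ => √(4 / (2 * n : ℝ)) + |mm (2 * n : ℝ) (Nc n) (hh q) / (2 * n : ℝ) - π q|)
        atTop (𝓝 0) := by
      have b1 : Tendsto (fun n : ℕ => √(4 / (2 * n : ℝ))) atTop (𝓝 0) := by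
        have := (hNT.const_div_atTop (4 : ℝ)).sqrt
        simpa using this
      have b2 : Tendsto (fun n : ℕ => mm (2 * n : ℝ) (Nc n) (hh q) / (2 * n : ℝ)) atTop (𝓝 (π q)) := by
        have inv0 : Tendsto (fun n : ℕ => (2 * n : ℝ)⁻¹) atTop (𝓝 0) := hNT.inv_tendsto_atTop
        have lim : Tendsto (fun n : ℕ => ((Nc n q.1 : ℝ) / (2 * n) * ((Nc n q.2 : ℝ) / (2 * n))
            - (if q.1 = q.2 then (Nc n q.1 : ℝ) / (2 * n) else 0) * (2 * n : ℝ)⁻¹)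
            / (1 - (2 * n : ℝ)⁻¹)) atTop (𝓝 ((p q.1 * p q.2 - (if q.1 = q.2 then p q.1 else 0) * 0)
              / (1 - 0))) := by
          refine Tendsto.div ?_ (tendsto_const_nhds.sub inv0) (by norm_num)
          refine ((hlim _).mul (hlim _)).sub (Tendsto.mul ?_ inv0)
          split_ifs
          · exact hlim _
          · exact tendsto_const_nhds
        have e0 : (p q.1 * p q.2 - (if q.1 = q.2 then p q.1 else 0) * 0) / (1 - 0) = π q := by
          simp [π]
        rw [e0] at lim
        refine lim.congr' ?_
        filter_upwards [eventually_ge_atTop 1] with n hn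
        have hn1 : (1 : ℝ) ≤ n := by exact_mod_cast hn
        rw [mm_hh]
        have x1 : (2 * n : ℝ) ≠ 0 := by positivity
        have x2 : (2 * n : ℝ) - 1 ≠ 0 := by
          have : (0 : ℝ) < 2 * n - 1 := by linarith
          exact this.ne'
        generalize (2 * n : ℝ) = N at *
        have x3 : 1 - N⁻¹ = (N - 1) / N := by field_simp
        rw [x3]
        split_ifs
        · field_simp
        · field_simp
          ring
      have b3 := (b2.sub_const (π q)).abs
      simpa using b1.add b3
    refine tendsto_of_tendsto_of_tendsto_of_le_of_le' tendsto_const_nhds hb ?_ ?_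
    · exact Eventually.of_forall fun n => by positivity
    · filter_upwards [hgood] with n hn
      have := ebound ptn ptn_inv ptn_ne (Nc n) hn.1 (by simp; omega) q (π q)
      rw [hcard] at this
      exact this
  have hd : Tendsto d atTop (𝓝 0) := by
    have hb : Tendsto (fun n : ℕ => ∑ q, ∑ r, GG h q r ^ 2 *
        ((∑ L ∈ Ω n, |XX ptn q L / (2 * n : ℝ) - π q|) / ((Ω n).card : ℝ)
        + (∑ L ∈ Ω n, |XX ptn r L / (2 * n : ℝ) - π r|) / ((Ω n).card : ℝ))
        + 16 / (2 * n : ℝ)) atTop (𝓝 0) := by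
      have b1 := hNT.const_div_atTop (16 : ℝ)
      have b2 : Tendsto (fun n : ℕ => ∑ q, ∑ r, GG h q r ^ 2 *
        ((∑ L ∈ Ω n, |XX ptn q L / (2 * n : ℝ) - π q|) / ((Ω n).card : ℝ)
        + (∑ L ∈ Ω n, |XX ptn r L / (2 * n : ℝ) - π r|) / ((Ω n).card : ℝ))) atTop
          (𝓝 (∑ q, ∑ r, GG h q r ^ 2 * (0 + 0))) :=
        tendsto_finsetSum _ fun q _ => tendsto_finsetSum _ fun r _ =>
          ((he q).add (he r)).const_mul _
      simpa using b2.add b1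
    refine tendsto_of_tendsto_of_tendsto_of_le_of_le' tendsto_const_nhds hb ?_ ?_
    · exact Eventually.of_forall fun n => by simp only [d]; positivity
    · filter_upwards [hgood] with n hn
      have := Fbound ptn ptn_inv ptn_ne h (hne_sym K) (hne_01 K) (Nc n) hn.1 (by simp; omega) π hπ
      rw [hcard] at this
      exact this
  -- γ
  let γ : ℕ → ℝ := fun n => 2 * c n * v n / (2 * n : ℝ) ^ 2
  have hFsum : ∀ n, (Ω n).Nonempty → 1 ≤ n →
      (∑ L ∈ Ω n, F n L) / ((Ω n).card : ℝ) = 2 * c n * v n := by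
    intro n hn h1
    have := abs_var (Ω n) sw (fun i L hL => sw_mem (Nc n) i L hL) sw_sw (S n) (m n) (c n) (hreg n h1)
    simp only [F, v]
    rw [this]; ring
  have hγd : ∀ n, (Ω n).Nonempty → 1 ≤ n → |γ n - G| ≤ d n := by
    intro n hn h1
    have hn0 : (0 : ℝ) < (Ω n).card := by exact_mod_cast hn.card_pos
    have : γ n - G = (∑ L ∈ Ω n, (F n L / (2 * n : ℝ) ^ 2 - G)) / ((Ω n).card : ℝ) := by
      simp only [γ]
      rw [← hFsum n hn h1, sum_sub_distrib, sum_const, nsmul_eq_mul, ← sum_div, sub_div]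
      congr 1
      · ring
      · field_simp
    rw [this, abs_div, abs_of_pos hn0]
    simp only [d]
    gcongr
    exact abs_sum_le_sum_abs _ _
  have hγ : Tendsto γ atTop (𝓝 G) := by
    rw [tendsto_iff_norm_sub_tendsto_zero]
    refine tendsto_of_tendsto_of_tendsto_of_le_of_le' tendsto_const_nhds hd ?_ ?_
    · exact Eventually.of_forall fun n => norm_nonneg _
    · filter_upwards [hgood] with n hn
      exact hγd n hn.1 hn.2
  have hvT : Tendsto v atTop atTop := by
    have h1 : Tendsto (fun n : ℕ => γ n * ((2 * n : ℝ) / 8)) atTop atTop :=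
      Tendsto.pos_mul_atTop hG hγ (hNT.atTop_div_const (by norm_num))
    refine tendsto_atTop_mono' _ ?_ h1
    filter_upwards [hgood] with n hn
    have hn1 : (1 : ℝ) ≤ n := by exact_mod_cast hn.2
    have hv0 : 0 ≤ v n := by simp only [v]; positivity
    simp only [γ, c]
    have x1 : 2 * (4 * (2 * (n : ℝ) - 1)) * v n / (2 * n : ℝ) ^ 2 * (2 * n / 8)
       = v n * ((2 * n - 1) / (2 * n)) := by
      field_simp
      ring
    rw [x1]
    refine mul_le_of_le_one_right hv0 ?_
    rw [div_le_one (by positivity)]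
    linarith
  have hsT : Tendsto (fun n => √(v n)) atTop atTop := Real.tendsto_sqrt_atTop.comp hvT
  have hgood2 : ∀ᶠ n : ℕ in atTop, ((Ω n).Nonempty ∧ 1 ≤ n) ∧ 0 < v n ∧ 0 < γ n :=
    hgood.and ((hvT.eventually_gt_atTop 0).and (hγ.eventually (lt_mem_nhds hG)))
  -- characteristic functions
  have hchar : ∀ t : ℝ, Tendsto (fun n => (∑ L ∈ Ω n, Complex.exp (Complex.I *
      (t * ((S n L - m n) / √(v n)) : ℝ))) / ((Ω n).card : ℂ)) atTop
      (𝓝 (Complex.exp (- t ^ 2 / 2))) := by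
    intro t
    rw [tendsto_iff_norm_sub_tendsto_zero]
    have hb : Tendsto (fun n => Real.exp (t ^ 2 / 2) * (|t| * (2 * d n / γ n)
      + 2 * t ^ 2 * 4 / √(v n)) * |t|) atTop
        (𝓝 (Real.exp (t ^ 2 / 2) * (|t| * (2 * 0 / G) + 0) * |t|)) := by
      refine (Tendsto.const_mul _ (Tendsto.add (Tendsto.const_mul _ ((hd.const_mul 2).div hγ hG.ne'))
        (hsT.const_div_atTop _))).mul_const _
    have e0 : Real.exp (t ^ 2 / 2) * (|t| * (2 * 0 / G) + 0) * |t| = 0 := by simp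
    rw [e0] at hb
    refine tendsto_of_tendsto_of_tendsto_of_le_of_le' tendsto_const_nhds hb
      (Eventually.of_forall fun n => norm_nonneg _) ?_
    filter_upwards [hgood2] with n ⟨⟨hn, h1⟩, hv, hg⟩
    have hn0 : (0 : ℝ) < (Ω n).card := by exact_mod_cast hn.card_pos
    have hn1 : (1 : ℝ) ≤ n := by exact_mod_cast h1
    have hs : 0 < √(v n) := Real.sqrt_pos.2 hv
    have hs2 : √(v n) ^ 2 = v n := Real.sq_sqrt hv.le
    have key := abs_charFun (Ω n) sw (fun i L hL => sw_mem (Nc n) i L hL) sw_sw (S n) (m n) (c n)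
      (hcpos n h1) (hreg n h1) 4 (√(v n)) t hn
      (fun L _ i => D_bound ptn ptn_inv ptn_ne h (hne_sym K) (hne_01 K) L i) hs (by norm_num)
      (by rw [hs2]; simp only [v]; field_simp)
    refine key.trans ?_
    have hA : (∑ L ∈ Ω n, |1 - (∑ i, (S n (sw i L) - S n L) ^ 2) / (2 * c n * √(v n) ^ 2)|)
          / ((Ω n).card : ℝ) ≤ 2 * d n / γ n := by
      have hpt : ∀ L ∈ Ω n, |1 - (∑ i, (S n (sw i L) - S n L) ^ 2) / (2 * c n * √(v n) ^ 2)|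
         ≤ (|γ n - G| + |F n L / (2 * n : ℝ) ^ 2 - G|) / γ n := by
        intro L _
        have hcn := hcpos n h1
        have x1 : 1 - (∑ i, (S n (sw i L) - S n L) ^ 2) / (2 * c n * √(v n) ^ 2)
          = ((γ n - G) - (F n L / (2 * n : ℝ) ^ 2 - G)) / γ n := by
          rw [hs2]
          simp only [γ, F]
          field_simp
          ring
        rw [x1, abs_div, abs_of_pos hg]
        gcongr
        exact abs_sub _ _
      calc _ ≤ (∑ L ∈ Ω n, (|γ n - G| + |F n L / (2 * n : ℝ) ^ 2 - G|) / γ n) / ((Ω n).card : ℝ) := by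
            gcongr with L hL
            exact hpt L hL
        _ = (|γ n - G| + d n) / γ n := by
            rw [← sum_div, sum_add_distrib, sum_const, nsmul_eq_mul]
            simp only [d]
            field_simp
        _ ≤ _ := by
            gcongr
            linarith [hγd n hn h1]
    gcongr
  have hfin := weak Ω (fun n L => (S n L - m n) / √(v n)) (hgood.mono fun n hn => hn.1) hchar f
  refine hfin.congr' ?_
  filter_upwards [hgood] with n ⟨hn, h1⟩
  have hn0 : (0 : ℝ) < (Ω n).card := by exact_mod_cast hn.card_pos
  have hRS : ∀ L, R n L = S n L / 2 := fun L => by rw [hR, R_eq]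
  have hE : expct n K (Nc n) (R n) = m n / 2 := by
    unfold expct
    rw [lab_eq]
    simp only [hRS]
    have := abs_mean (Ω n) sw (fun i L hL => sw_mem (Nc n) i L hL) sw_sw (S n) (m n) (c n)
      (hcpos n h1) (hreg n h1)
    rw [← sum_div, this]
    simp only [Ω] at hn0 ⊢
    field_simp
  have hV : variance n K (Nc n) (R n) = v n / 4 := by
    unfold variance
    rw [hE]
    unfold expct
    rw [lab_eq]
    simp only [hRS, v, Ω]
    rw [div_right_comm]
    congr 1
    rw [sum_div]
    refine sum_congr rfl fun L _ => by ring
  have hsq : √(v n / 4) = √(v n) / 2 := by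
    rw [Real.sqrt_div' _ (by norm_num)]
    congr 1
    rw [show (4 : ℝ) = 2 ^ 2 by norm_num]
    exact Real.sqrt_sq (by norm_num)
  rw [hE, hV, hsq]
  unfold expct
  rw [lab_eq]
  simp only [hRS, Ω]
  congr 1
  refine sum_congr rfl fun L _ => ?_
  congr 1
  rw [← sub_div, div_div_div_cancel_right₀ (by norm_num)]

end Crossmatch
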